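/- Let ℓ ≥ 1 be an integer and let T be a smooth function on a dilation-invariant open set U ⊆ ℝ^N, homogeneous of degree ℓ − n/2. Then for every index 1 ≤ i ≤ N, Δ^{ℓ−1}(DᵢT) = −εᵢ xᵢ · Δ^{ℓ} T on U. (This is the conformally flat, scalar case of the paper's Lemma expressing Δ̃^{ℓ−1}D̃T = −X Δ̃^{ℓ}T plus curvature terms: in the flat model all curvature terms vanish and the identity is exact.) -/

import Mathlib

noncomputable section

open scoped BigOperators

/-- The `i`-th partial derivative of a function on `ℝ^N`. -/
def pderiv' {N : ℕ} (i : Fin N) (f : (Fin N → ℝ) → ℝ) : (Fin N → ℝ) → ℝ :=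
  fun x => fderiv ℝ f x (Pi.single i 1)

/-- The flat pseudo-Laplacian `Δf = ∑ i, εᵢ ∂²f/∂xᵢ²` with signs `ε`. -/
def lapE {N : ℕ} (ε : Fin N → ℝ) (f : (Fin N → ℝ) → ℝ) : (Fin N → ℝ) → ℝ :=
  fun x => ∑ i, ε i * pderiv' i (pderiv' i f) x

/-- The Euler operator `(Ef)(x) = ∑ i, xᵢ ∂f/∂xᵢ (x)`. -/
def eulerOp {N : ℕ} (f : (Fin N → ℝ) → ℝ) : (Fin N → ℝ) → ℝ :=
  fun x => ∑ i, x i * pderiv' i f x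

/-- The quadratic form `Q(x) = ∑ i, εᵢ xᵢ²`. -/
def Qform {N : ℕ} (ε : Fin N → ℝ) : (Fin N → ℝ) → ℝ :=
  fun x => ∑ i, ε i * (x i) ^ 2

/-- An open set `U ⊆ ℝ^N` is dilation-invariant if `t • x ∈ U` for `x ∈ U`, `t > 0`. -/
def DilationInvariant {N : ℕ} (U : Set (Fin N → ℝ)) : Prop :=
  ∀ x ∈ U, ∀ t : ℝ, 0 < t → t • x ∈ U

/-- `f` is homogeneous of degree `w` on `U`: `f(t • x) = t^w f(x)` for `x ∈ U`, `t > 0`. -/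
def HomogeneousOn {N : ℕ} (f : (Fin N → ℝ) → ℝ) (w : ℝ) (U : Set (Fin N → ℝ)) : Prop :=
  ∀ x ∈ U, ∀ t : ℝ, 0 < t → f (t • x) = t ^ w * f x

/-- The `i`-th component of the flat tractor-D operator:
`Dᵢ f = ∂ᵢ((n + 2E − 2) f) − εᵢ xᵢ Δf`. -/
def Dop {N : ℕ} (n : ℕ) (ε : Fin N → ℝ) (i : Fin N) (f : (Fin N → ℝ) → ℝ) :
    (Fin N → ℝ) → ℝ :=
  fun x => pderiv' i (fun y => (n : ℝ) * f y + 2 * eulerOp f y - 2 * f y) x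
    - ε i * x i * lapE ε f x

section helpers
variable {N : ℕ} {U : Set (Fin N → ℝ)}

lemma pd_congr (hU : IsOpen U) {f g : (Fin N → ℝ) → ℝ} (h : Set.EqOn f g U) (i : Fin N) :
    Set.EqOn (pderiv' i f) (pderiv' i g) U := by
  intro x hx
  have : f =ᶠ[nhds x] g := Filter.eventuallyEq_of_mem (hU.mem_nhds hx) h
  simp only [pderiv', this.fderiv_eq]

lemma pd_smooth (hU : IsOpen U) {f : (Fin N → ℝ) → ℝ} (h : ContDiffOn ℝ (⊤ : ℕ∞) f U)
    (i : Fin N) : ContDiffOn ℝ (⊤ : ℕ∞) (pderiv' i f) U := by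
  have h1 : ContDiffOn ℝ (⊤ : ℕ∞) (fderiv ℝ f) U := h.fderiv_of_isOpen hU (by simp)
  exact h1.clm_apply contDiffOn_const

lemma sm_diff (hU : IsOpen U) {f : (Fin N → ℝ) → ℝ} (h : ContDiffOn ℝ (⊤ : ℕ∞) f U)
    {x : Fin N → ℝ} (hx : x ∈ U) : DifferentiableAt ℝ f x :=
  (h.contDiffAt (hU.mem_nhds hx)).differentiableAt (by simp)

lemma lap_congr (hU : IsOpen U) (ε : Fin N → ℝ) {f g : (Fin N → ℝ) → ℝ} (h : Set.EqOn f g U) :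
    Set.EqOn (lapE ε f) (lapE ε g) U := by
  intro x hx
  simp only [lapE]
  exact Finset.sum_congr rfl fun i _ => by rw [pd_congr hU (pd_congr hU h i) i hx]

lemma lap_smooth (hU : IsOpen U) (ε : Fin N → ℝ) {f : (Fin N → ℝ) → ℝ}
    (h : ContDiffOn ℝ (⊤ : ℕ∞) f U) : ContDiffOn ℝ (⊤ : ℕ∞) (lapE ε f) U :=
  ContDiffOn.sum fun i _ => contDiffOn_const.mul (pd_smooth hU (pd_smooth hU h i) i)

lemma pd_comm (hU : IsOpen U) {f : (Fin N → ℝ) → ℝ} (h : ContDiffOn ℝ (⊤ : ℕ∞) f U)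
    (i j : Fin N) : Set.EqOn (pderiv' i (pderiv' j f)) (pderiv' j (pderiv' i f)) U := by
  intro x hx
  have h1 : DifferentiableAt ℝ (fderiv ℝ f) x :=
    ((h.fderiv_of_isOpen (m := (⊤ : ℕ∞)) hU (by simp)).contDiffAt (hU.mem_nhds hx)).differentiableAt
      (by simp)
  have h2 : ∀ v : Fin N → ℝ, ∀ w, fderiv ℝ (fun y => fderiv ℝ f y v) x w
      = fderiv ℝ (fderiv ℝ f) x w v := by
    intro v w
    rw [fderiv_clm_apply h1 (differentiableAt_const v)]
    simp
  have h3 : IsSymmSndFDerivAt ℝ f x :=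
    (h.contDiffAt (hU.mem_nhds hx)).isSymmSndFDerivAt (by
      simp only [minSmoothness_of_isRCLikeNormedField]
      exact WithTop.coe_le_coe.2 (le_top (a := (2 : ℕ∞))))
  change fderiv ℝ (fun y => fderiv ℝ f y _) x _ = fderiv ℝ (fun y => fderiv ℝ f y _) x _
  rw [h2, h2]
  exact h3.eq _ _

lemma pd_sub {f g : (Fin N → ℝ) → ℝ} {x : Fin N → ℝ} (hf : DifferentiableAt ℝ f x)
    (hg : DifferentiableAt ℝ g x) (i : Fin N) :
    pderiv' i (fun y => f y - g y) x = pderiv' i f x - pderiv' i g x := by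
  simp only [pderiv']
  rw [fderiv_fun_sub hf hg]; simp

lemma pd_add {f g : (Fin N → ℝ) → ℝ} {x : Fin N → ℝ} (hf : DifferentiableAt ℝ f x)
    (hg : DifferentiableAt ℝ g x) (i : Fin N) :
    pderiv' i (fun y => f y + g y) x = pderiv' i f x + pderiv' i g x := by
  simp only [pderiv']
  rw [fderiv_fun_add hf hg]; simp

lemma pd_cmul {f : (Fin N → ℝ) → ℝ} {x : Fin N → ℝ} (hf : DifferentiableAt ℝ f x)
    (c : ℝ) (i : Fin N) :
    pderiv' i (fun y => c * f y) x = c * pderiv' i f x := by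
  simp only [pderiv']
  rw [fderiv_const_mul hf]; simp

lemma pd_xmul {f : (Fin N → ℝ) → ℝ} {x : Fin N → ℝ} (hf : DifferentiableAt ℝ f x)
    (i j : Fin N) :
    pderiv' j (fun y => y i * f y) x = x i * pderiv' j f x + (if i = j then 1 else 0) * f x := by
  have h1 : HasFDerivAt (fun y : Fin N → ℝ => y i)
    (ContinuousLinearMap.proj (R := ℝ) (φ := fun _ : Fin N => ℝ) i) x := hasFDerivAt_apply i x
  simp only [pderiv']
  rw [(h1.fun_mul hf.hasFDerivAt).fderiv]
  simp [Pi.single_apply, mul_comm]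

lemma pd_sum {f : Fin N → (Fin N → ℝ) → ℝ} {x : Fin N → ℝ}
    (hf : ∀ k, DifferentiableAt ℝ (f k) x) (i : Fin N) :
    pderiv' i (fun y => ∑ k, f k y) x = ∑ k, pderiv' i (f k) x := by
  simp only [pderiv']
  rw [fderiv_fun_sum fun k _ => hf k]; simp

lemma lap_pd (hU : IsOpen U) (ε : Fin N → ℝ) {f : (Fin N → ℝ) → ℝ}
    (h : ContDiffOn ℝ (⊤ : ℕ∞) f U) (i : Fin N) :
    Set.EqOn (lapE ε (pderiv' i f)) (pderiv' i (lapE ε f)) U := by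
  intro x hx
  have hs := fun k => pd_smooth hU (pd_smooth hU h k) k
  have : pderiv' i (lapE ε f) x = ∑ k, pderiv' i (fun y => ε k * pderiv' k (pderiv' k f) y) x :=
    pd_sum (fun k => (sm_diff hU (hs k) hx).const_mul _) i
  rw [this]
  refine Finset.sum_congr rfl fun k _ => ?_
  rw [pd_cmul (sm_diff hU (hs k) hx), pd_congr hU (pd_comm hU h k i) k hx,
    pd_comm hU (pd_smooth hU h k) k i hx]

lemma lap_lin (hU : IsOpen U) (ε : Fin N → ℝ) {f g : (Fin N → ℝ) → ℝ}
    (hf : ContDiffOn ℝ (⊤ : ℕ∞) f U) (hg : ContDiffOn ℝ (⊤ : ℕ∞) g U) (a b : ℝ) :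
    Set.EqOn (lapE ε (fun y => a * f y - b * g y)) (fun y => a * lapE ε f y - b * lapE ε g y) U := by
  have key : ∀ {f g : (Fin N → ℝ) → ℝ}, ContDiffOn ℝ (⊤ : ℕ∞) f U → ContDiffOn ℝ (⊤ : ℕ∞) g U →
      ∀ k, Set.EqOn (pderiv' k (fun y => a * f y - b * g y))
        (fun y => a * pderiv' k f y - b * pderiv' k g y) U := by
    intro f g hf hg k x hx
    rw [pd_sub ((sm_diff hU hf hx).const_mul _) ((sm_diff hU hg hx).const_mul _),
      pd_cmul (sm_diff hU hf hx), pd_cmul (sm_diff hU hg hx)]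
  intro x hx
  simp only [lapE, Finset.mul_sum, ← Finset.sum_sub_distrib]
  refine Finset.sum_congr rfl fun k _ => ?_
  rw [pd_congr hU (key hf hg k) k hx, key (pd_smooth hU hf k) (pd_smooth hU hg k) k hx]
  ring

lemma x_smooth (i : Fin N) : ContDiffOn ℝ (⊤ : ℕ∞) (fun y : Fin N → ℝ => y i) U :=
  (contDiff_apply ℝ ℝ i).contDiffOn

lemma lap_xmul (hU : IsOpen U) (ε : Fin N → ℝ) {f : (Fin N → ℝ) → ℝ}
    (hf : ContDiffOn ℝ (⊤ : ℕ∞) f U) (i : Fin N) :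
    Set.EqOn (lapE ε (fun y => y i * f y))
      (fun y => y i * lapE ε f y + 2 * ε i * pderiv' i f y) U := by
  intro x hx
  have h2 : ∀ k, pderiv' k (pderiv' k (fun y => y i * f y)) x
      = x i * pderiv' k (pderiv' k f) x + 2 * ((if i = k then 1 else 0) * pderiv' k f x) := by
    intro k
    have h1 : Set.EqOn (pderiv' k (fun y => y i * f y))
      (fun y => y i * pderiv' k f y + (if i = k then 1 else 0) * f y) U :=
      fun y hy => pd_xmul (sm_diff hU hf hy) i k
    have hk := pd_smooth hU hf k
    rw [pd_congr hU h1 k hx, pd_add (sm_diff hU ((x_smooth i).mul hk) hx)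
      ((sm_diff hU hf hx).const_mul _), pd_xmul (sm_diff hU hk hx), pd_cmul (sm_diff hU hf hx)]
    ring
  simp only [lapE, h2, mul_add, Finset.sum_add_distrib, Finset.mul_sum]
  congr 1
  · exact Finset.sum_congr rfl fun k _ => by ring
  · simp; ring

lemma lap_iter_smooth (hU : IsOpen U) (ε : Fin N → ℝ) {f : (Fin N → ℝ) → ℝ}
    (h : ContDiffOn ℝ (⊤ : ℕ∞) f U) (k : ℕ) : ContDiffOn ℝ (⊤ : ℕ∞) ((lapE ε)^[k] f) U := by
  induction k with
  | zero => exact h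
  | succ k ih => rw [Function.iterate_succ_apply']; exact lap_smooth hU ε ih

lemma main_iter (hU : IsOpen U) (ε : Fin N → ℝ) (hε : ∀ i, ε i = 1 ∨ ε i = -1)
    {T D : (Fin N → ℝ) → ℝ} (hT : ContDiffOn ℝ (⊤ : ℕ∞) T U) (i : Fin N) (c : ℝ)
    (hD : Set.EqOn D (fun y => c * pderiv' i T y - ε i * (y i * lapE ε T y)) U) (k : ℕ) :
    Set.EqOn ((lapE ε)^[k] D) (fun y => (c - 2 * k) * pderiv' i ((lapE ε)^[k] T) y
      - ε i * (y i * lapE ε ((lapE ε)^[k] T) y)) U := by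
  induction k with
  | zero => simpa using hD
  | succ k ih =>
    have hS := lap_iter_smooth hU ε hT k
    simp only [Function.iterate_succ_apply']
    generalize (lapE ε)^[k] T = S at ih hS
    intro x hx
    have hL := lap_smooth hU ε hS
    rw [lap_congr hU ε ih hx, lap_lin hU ε (pd_smooth hU hS i) ((x_smooth i).mul hL) _ _ hx]
    simp only []
    rw [lap_pd hU ε hS i hx, lap_xmul hU ε hL i hx]
    have he : ε i * ε i = 1 := by rcases hε i with h | h <;> rw [h] <;> norm_num
    push_cast
    linear_combination (-2 * pderiv' i (lapE ε S) x) * he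

lemma euler_hom (hU : IsOpen U) {T : (Fin N → ℝ) → ℝ} (hT : ContDiffOn ℝ (⊤ : ℕ∞) T U) (w : ℝ)
    (hh : HomogeneousOn T w U) : Set.EqOn (eulerOp T) (fun y => w * T y) U := by
  intro x hx
  have hd := sm_diff hU hT hx
  have h1 : HasDerivAt (fun t : ℝ => T (t • x)) (fderiv ℝ T x x) 1 := by
    have hl : HasDerivAt (fun t : ℝ => t • x) x 1 := by
      simpa using (hasDerivAt_id (1 : ℝ)).smul_const x
    have hd' : HasFDerivAt T (fderiv ℝ T x) ((1 : ℝ) • x) := by simpa using hd.hasFDerivAt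
    exact hd'.comp_hasDerivAt (1 : ℝ) hl
  have h2 : HasDerivAt (fun t : ℝ => t ^ w * T x) (w * T x) 1 := by
    simpa using (Real.hasDerivAt_rpow_const (x := 1) (p := w) (Or.inl one_ne_zero)).mul_const (T x)
  have h3 : (fun t : ℝ => T (t • x)) =ᶠ[nhds 1] (fun t : ℝ => t ^ w * T x) := by
    filter_upwards [lt_mem_nhds (zero_lt_one (α := ℝ))] with t ht using hh x hx t ht
  have h4 := (h2.congr_of_eventuallyEq h3).unique h1
  change _ = w * T x
  rw [h4]
  conv_rhs => rw [pi_eq_sum_univ' x]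
  simp only [eulerOp, pderiv', map_sum, map_smul, smul_eq_mul]
  refine Finset.sum_congr rfl fun k _ => ?_
  congr 2
  rw [← pi_eq_sum_univ' x]

end helpers

/-- Flat scalar case of `Δ^(ℓ−1) D T = −X Δ^ℓ T` on functions homogeneous of
degree `ℓ − n/2`. -/
theorem lap_pow_Dop (n : ℕ) (hn : 1 ≤ n) (ε : Fin (n + 2) → ℝ)
    (hε : ∀ i, ε i = 1 ∨ ε i = -1)
    (U : Set (Fin (n + 2) → ℝ)) (hU : IsOpen U) (hUdil : DilationInvariant U)
    (ℓ : ℕ) (hℓ : 1 ≤ ℓ)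
    (T : (Fin (n + 2) → ℝ) → ℝ) (hT : ContDiffOn ℝ (⊤ : ℕ∞) T U)
    (hThom : HomogeneousOn T ((ℓ : ℝ) - (n : ℝ) / 2) U) :
    ∀ i : Fin (n + 2), ∀ x ∈ U,
      (lapE ε)^[ℓ - 1] (Dop n ε i T) x = -(ε i * x i) * (lapE ε)^[ℓ] T x := by
  intro i x hx
  obtain ⟨k, rfl⟩ : ∃ k, ℓ = k + 1 := ⟨ℓ - 1, by omega⟩
  have hE := euler_hom hU hT _ hThom
  have hD : Set.EqOn (Dop n ε i T)
      (fun y => (2 * k : ℝ) * pderiv' i T y - ε i * (y i * lapE ε T y)) U := by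
    intro y hy
    have h1 : Set.EqOn (fun y => (n : ℝ) * T y + 2 * eulerOp T y - 2 * T y)
        (fun y => (2 * k : ℝ) * T y) U := by
      intro z hz
      simp only [hE hz]
      push_cast
      ring
    simp only [Dop]
    rw [pd_congr hU h1 i hy, pd_cmul (sm_diff hU hT hy)]
    ring
  have := main_iter hU ε hε hT i _ hD k hx
  rw [Nat.add_sub_cancel, this, Function.iterate_succ_apply']
  ring
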